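/- arXiv:2004.13115 — 6 statements merged into one kernel-verified Lean document; each statement's English description precedes it below -/
import Mathlib

section
/- Let F be a field, t a natural number, x : Fin t → F an injective family of pairwise distinct nonzero points, y : Fin t → F arbitrary values, and s ∈ F any secret. Then there exists a unique polynomial f ∈ F[X] with natDegree f ≤ t such that f.eval 0 = s and f.eval (x i) = y i for every i. In particular, any t shares of a threshold-t Shamir secret sharing are consistent with every possible secret (perfect secrecy below the threshold). -/
/-- Shamir secret sharing: any `t` shares at distinct nonzero points are consistent with
every possible secret `s`, via a unique polynomial of degree at most `t`. -/
theorem shamir_perfect_secrecy {F : Type*} [Field F] (t : ℕ) (x : Fin t → F)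
    (hx : Function.Injective x) (hx0 : ∀ i, x i ≠ 0)
    (y : Fin t → F) (s : F) :
    ∃! f : Polynomial F, f.natDegree ≤ t ∧ f.eval 0 = s ∧ ∀ i, f.eval (x i) = y i := by
  have hv : Set.InjOn (Fin.cons 0 x : Fin (t + 1) → F) (Finset.univ : Finset (Fin (t + 1))) :=
    (Fin.cons_injective_iff.mpr ⟨fun ⟨i, hi⟩ => hx0 i hi, hx⟩).injOn
  have key (f : Polynomial F) :
      (f.natDegree ≤ t ∧ f.eval 0 = s ∧ ∀ i, f.eval (x i) = y i) ↔
        f = Lagrange.interpolate Finset.univ (Fin.cons 0 x : Fin (t + 1) → F)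
          (Fin.cons s y : Fin (t + 1) → F) := by
    rw [← Lagrange.eq_interpolate_iff _ hv, Finset.card_fin,
      ← Polynomial.mem_degreeLT, Polynomial.degreeLT_succ_eq_degreeLE, Polynomial.mem_degreeLE,
      ← Polynomial.natDegree_le_iff_degree_le]
    simp [Fin.forall_fin_succ]
  simp only [key]
  exact existsUnique_eq
end

section
/- Let F be a field, t a natural number, f, g ∈ F[X] polynomials with natDegree f ≤ t and natDegree g ≤ t, and x : Fin (t+1) → F injective. Then the Lagrange interpolation polynomial through the points (x i, f.eval (x i) + g.eval (x i)), evaluated at 0, equals f.eval 0 + g.eval 0. That is, adding Shamir shares pointwise and reconstructing from t+1 points yields the sum of the two secrets (additive homomorphism of Shamir's scheme). -/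
/-- Additive homomorphism of Shamir's scheme: adding shares pointwise and reconstructing
from `t+1` points via Lagrange interpolation yields the sum of the two secrets. -/
theorem shamir_additive_homomorphism {F : Type*} [Field F] (t : ℕ) (f g : Polynomial F)
    (hf : f.natDegree ≤ t) (hg : g.natDegree ≤ t)
    (x : Fin (t + 1) → F) (hx : Function.Injective x) :
    (Lagrange.interpolate Finset.univ x
        (fun i => f.eval (x i) + g.eval (x i))).eval 0 = f.eval 0 + g.eval 0 := by
  have hdeg : (f + g).degree < (Finset.univ : Finset (Fin (t + 1))).card := by
    rw [Finset.card_fin]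
    exact (Polynomial.degree_le_of_natDegree_le
      (Polynomial.natDegree_add_le_of_degree_le hf hg)).trans_lt
        (Nat.cast_lt.mpr t.lt_succ_self)
  rw [← Lagrange.eq_interpolate_of_eval_eq _ hx.injOn hdeg fun _ _ => Polynomial.eval_add,
    Polynomial.eval_add]
end

section
/- Let F be a field, l and d positive natural numbers, and let f, g : Fin l → Fin d → F[X] be families of polynomials with natDegree (f j p) ≤ 1 and natDegree (g j p) ≤ 1 for all j ∈ Fin l and p ∈ Fin d. Let x : Fin (2l+1) → F be injective. Then the Lagrange interpolation polynomial through the 2l+1 points (x i, Π_{j ∈ Fin l} Σ_{p ∈ Fin d} (f j p).eval (x i) · (g j p).eval (x i)), evaluated at 0, equals Π_{j ∈ Fin l} Σ_{p ∈ Fin d} (f j p).eval 0 · (g j p).eval 0. That is, matching a pattern of length l using degree-1 shares produces a polynomial of degree at most 2l, so 2l+1 shares suffice for the user to reconstruct the matching result in one communication round. -/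
/-- Matching a length-`l` string with degree-1 shares yields a polynomial of degree at most
`2 * l`. -/
theorem natDegree_prod_sum_mul_le {F : Type*} [Field F] {l d : ℕ}
    {f g : Fin l → Fin d → Polynomial F}
    (hf : ∀ j p, (f j p).natDegree ≤ 1) (hg : ∀ j p, (g j p).natDegree ≤ 1) :
    (∏ j, ∑ p, f j p * g j p).natDegree ≤ 2 * l := by
  calc (∏ j, ∑ p, f j p * g j p).natDegree
      ≤ ∑ j, (∑ p, f j p * g j p).natDegree := Polynomial.natDegree_prod_le _ _
    _ ≤ ∑ _j : Fin l, 2 := Finset.sum_le_sum fun j _ =>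
        Polynomial.natDegree_sum_le_of_forall_le _ _ fun p _ =>
          Polynomial.natDegree_mul_le_of_le (hf j p) (hg j p)
    _ = 2 * l := by simp [mul_comm]

/-- Matching a pattern of length `l` using degree-1 shares produces a polynomial of degree
at most `2l`, so `2l+1` shares suffice for the user to reconstruct the matching result in
one communication round. -/
theorem string_matching_reconstruction {F : Type*} [Field F] (l d : ℕ)
    (hl : 0 < l) (hd : 0 < d) (f g : Fin l → Fin d → Polynomial F)
    (hf : ∀ j p, (f j p).natDegree ≤ 1) (hg : ∀ j p, (g j p).natDegree ≤ 1)
    (x : Fin (2 * l + 1) → F) (hx : Function.Injective x) :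
    (Lagrange.interpolate Finset.univ x
        (fun i => ∏ j, ∑ p, (f j p).eval (x i) * (g j p).eval (x i))).eval 0
      = ∏ j, ∑ p, (f j p).eval 0 * (g j p).eval 0 := by
  have hdeg : (∏ j, ∑ p, f j p * g j p).degree <
      (Finset.univ : Finset (Fin (2 * l + 1))).card := by
    rw [Finset.card_univ, Fintype.card_fin]
    exact Polynomial.degree_le_natDegree.trans_lt
      (by exact_mod_cast Nat.lt_succ_of_le (natDegree_prod_sum_mul_le hf hg))
  rw [← Lagrange.eq_interpolate_of_eval_eq _ hx.injOn hdeg fun i _ => by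
    simp [Polynomial.eval_prod, Polynomial.eval_finsetSum]]
  simp [Polynomial.eval_prod, Polynomial.eval_finsetSum]
end

section
/- Let R be a commutative ring, n and m natural numbers with m ≥ 1, V a type with decidable equality, A : Fin n → Fin m → V a relation, v : Fin m → V a disjunctive query predicate, and b : Fin n → R the values of the attribute being summed. For each tuple k let L_k be the list of indicators (if A k i = v i then (1:R) else 0) for i ∈ Fin m and let or2 a b = a + b − a·b. Then Σ_{k ∈ Fin n} b k · List.foldl or2 0 L_k equals Σ_{k ∈ S} b k, where S is the set of tuples k with A k i = v i for some i ∈ Fin m. That is, multiplying each tuple's summand by the OR-combination of its per-attribute indicators correctly computes the answer to a disjunctive sum query. -/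
/-- Folding 0/1 indicators with `a + b - a * b` computes the indicator of the disjunction. -/
theorem foldl_or_indicator {R ι : Type*} [CommRing R] (p : ι → Prop) [DecidablePred p]
    (l : List ι) (q : Prop) [Decidable q] [Decidable (q ∨ ∃ x ∈ l, p x)] :
    List.foldl (fun a b => a + b - a * b) (if q then (1 : R) else 0)
        (l.map fun x => if p x then (1 : R) else 0)
      = if q ∨ ∃ x ∈ l, p x then 1 else 0 := by
  classical
  induction l generalizing q with
  | nil => simp
  | cons x l ih =>
    have h : (if q then (1 : R) else 0) + (if p x then 1 else 0)
        - (if q then 1 else 0) * (if p x then 1 else 0) = if q ∨ p x then 1 else 0 := by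
      by_cases hq : q <;> by_cases hx : p x <;> simp [hq, hx]
    rw [List.map_cons, List.foldl_cons, h, ih]
    simp only [List.exists_mem_cons_iff, or_assoc]


/-- Multiplying each tuple's summand by the OR-combination of its per-attribute equality
indicators and adding over all tuples correctly computes the answer to a disjunctive
sum query. -/
theorem disjunctive_sum_correct {R : Type*} [CommRing R] (n m : ℕ) (hm : 1 ≤ m)
    {V : Type*} [DecidableEq V] (A : Fin n → Fin m → V) (v : Fin m → V)
    (b : Fin n → R) :
    (∑ k, b k * List.foldl (fun a b => a + b - a * b) 0
        (List.ofFn (fun i : Fin m => if A k i = v i then (1 : R) else 0)))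
      = ∑ k ∈ Finset.univ.filter (fun k : Fin n => ∃ i, A k i = v i), b k := by
  rw [Finset.sum_filter]
  refine Finset.sum_congr rfl fun k _ => ?_
  have h := foldl_or_indicator (R := R) (fun i => A k i = v i) (List.finRange m) False
  simp only [if_false, false_or, List.mem_finRange, true_and] at h
  rw [List.ofFn_eq_map, h, mul_ite, mul_one, mul_zero]
end

section
/- Let n be a natural number, o : Fin n → ℕ with o k ∈ {0, 1} for all k, and for each k let a k = Σ_{j ∈ Fin n, j ≤ k} o j be the accumulated count up to position k. Let x be a natural number with 1 ≤ x ≤ Σ_{k ∈ Fin n} o k. Then: (i) there is exactly one index k₀ ∈ Fin n with o k₀ = 1 and a k₀ = x, namely the x-th index (in increasing order) at which o equals 1; and (ii) for any tuple-id assignment r : Fin n → ℤ, Σ_{k ∈ Fin n} r k · (o k : ℤ) · (if a k = x then 1 else 0) = r k₀. That is, the x-th column of the oblivious tuple-id-finding method accumulates exactly the tuple-id of the x-th tuple satisfying the query predicate. -/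
/-- The running sum strictly increases on reaching an index with a positive value. -/
theorem sum_filter_le_lt_of_lt {ι : Type*} [Fintype ι] [LinearOrder ι] (o : ι → ℕ) {i j : ι}
    (hij : i < j) (hj : 0 < o j) :
    ∑ l ∈ Finset.univ.filter (fun l => l ≤ i), o l <
      ∑ l ∈ Finset.univ.filter (fun l => l ≤ j), o l := by
  refine Finset.sum_lt_sum_of_subset (i := j) ?_ ?_ ?_ hj fun _ _ _ => Nat.zero_le _
  · intro l hl
    simp only [Finset.mem_filter, Finset.mem_univ, true_and] at hl ⊢
    exact hl.trans hij.le
  · simp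
  · simpa using hij

/-- An index with value `1` is determined by its running sum. -/
theorem eq_of_sum_filter_le_eq {ι : Type*} [Fintype ι] [LinearOrder ι] (o : ι → ℕ) {i j : ι}
    (hi : o i = 1) (hj : o j = 1)
    (h : ∑ l ∈ Finset.univ.filter (fun l => l ≤ i), o l =
      ∑ l ∈ Finset.univ.filter (fun l => l ≤ j), o l) : i = j := by
  rcases lt_trichotomy i j with hij | hij | hij
  · exact absurd h (sum_filter_le_lt_of_lt o hij (by omega)).ne
  · exact hij
  · exact absurd h (sum_filter_le_lt_of_lt o hij (by omega)).ne'

/-- Running sums of a `0`/`1`-valued function attain every positive value up to the total sum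
at an index with value `1`. -/
theorem exists_sum_filter_le_eq {ι : Type*} [Fintype ι] [LinearOrder ι] (o : ι → ℕ)
    (ho : ∀ k, o k = 0 ∨ o k = 1) {x : ℕ} (hx1 : 1 ≤ x) (hx2 : x ≤ ∑ k, o k) :
    ∃ k, o k = 1 ∧ ∑ j ∈ Finset.univ.filter (fun j => j ≤ k), o j = x := by
  have hne : (Finset.univ : Finset ι).Nonempty :=
    Finset.nonempty_of_sum_ne_zero (f := o) (by omega)
  let S : Finset ι :=
    Finset.univ.filter fun k => x ≤ ∑ j ∈ Finset.univ.filter (fun j => j ≤ k), o j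
  have hS : S.Nonempty := by
    refine ⟨Finset.univ.max' hne, ?_⟩
    simp only [S, Finset.mem_filter, Finset.mem_univ, true_and]
    rwa [Finset.filter_true_of_mem fun j hj => Finset.le_max' _ j hj]
  obtain ⟨k, hk⟩ : ∃ k, k = S.min' hS := ⟨_, rfl⟩
  have hkS : x ≤ ∑ j ∈ Finset.univ.filter (fun j => j ≤ k), o j := by
    have := S.min'_mem hS
    rw [← hk] at this
    simpa [S] using this
  have hlt : ∑ j ∈ Finset.univ.filter (fun j => j < k), o j < x := by
    by_contra! h
    have hT : (Finset.univ.filter fun j => j < k).Nonempty :=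
      Finset.nonempty_of_sum_ne_zero (f := o) (by omega)
    obtain ⟨m, hm⟩ : ∃ m, m = Finset.max' _ hT := ⟨_, rfl⟩
    have hmk : m < k := by
      have := Finset.max'_mem _ hT
      rw [← hm] at this
      simpa using this
    have hmS : m ∈ S := by
      simp only [S, Finset.mem_filter, Finset.mem_univ, true_and]
      refine h.trans (Finset.sum_le_sum_of_subset fun j hj => ?_)
      have := Finset.le_max' _ j hj
      rw [← hm] at this
      simpa using this
    exact absurd (S.min'_le m hmS) (by rw [← hk]; exact not_le.mpr hmk)
  have hsplit : ∑ j ∈ Finset.univ.filter (fun j => j ≤ k), o j =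
      o k + ∑ j ∈ Finset.univ.filter (fun j => j < k), o j := by
    rw [← Finset.sum_insert (by simp)]
    congr 1
    ext j
    simp [le_iff_eq_or_lt]
  refine ⟨k, ?_, ?_⟩ <;> rcases ho k with h | h <;> omega


/-- Correctness of the oblivious tuple-id finding method: there is exactly one index at
which the string-matching resultant is `1` and the accumulated count equals `x`, and the
`x`-th column accumulates exactly the tuple-id of that index. -/
theorem tuple_id_finding_correct (n : ℕ) (o : Fin n → ℕ)
    (ho : ∀ k, o k = 0 ∨ o k = 1) (x : ℕ) (hx1 : 1 ≤ x) (hx2 : x ≤ ∑ k, o k) :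
    let a : Fin n → ℕ := fun k => ∑ j ∈ Finset.univ.filter (fun j : Fin n => j ≤ k), o j
    (∃! k₀ : Fin n, o k₀ = 1 ∧ a k₀ = x) ∧
    (∀ (r : Fin n → ℤ) (k₀ : Fin n), o k₀ = 1 → a k₀ = x →
      (∑ k, r k * (o k : ℤ) * (if a k = x then 1 else 0)) = r k₀) := by
  intro a
  have huniq : ∀ i j, o i = 1 → o j = 1 → a i = a j → i = j :=
    fun i j hi hj h => eq_of_sum_filter_le_eq o hi hj h
  obtain ⟨k, hk, hak⟩ : ∃ k, o k = 1 ∧ a k = x := exists_sum_filter_le_eq o ho hx1 hx2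
  refine ⟨⟨k, ⟨hk, hak⟩, fun i hi => huniq i k hi.1 hk (hi.2.trans hak.symm)⟩, ?_⟩
  intro r k₀ h₀ ha₀
  rw [Finset.sum_eq_single k₀ _ (by simp)]
  · simp [h₀, ha₀]
  · intro i _ hi
    rcases ho i with h | h
    · simp [h]
    · rw [if_neg fun hai => hi (huniq i k₀ h h₀ (hai.trans ha₀.symm)), mul_zero]
end

section
/- Let s be a positive natural number, α a linear order, v : Fin (s·s) → α, and r a natural number with 1 ≤ r ≤ s·s; call index i 'real' if (i : ℕ) < r. Partition the indices into s consecutive groups of size s, where index i belongs to group ⌊i/s⌋, and let q★ = ⌊(r−1)/s⌋ be the group containing the last real index. Then every group q < q★ consists entirely of real indices, and the maximum of v over the real indices equals the maximum of the following candidate values: the per-group maxima of v over the groups q = 0, …, q★ − 1, together with the values v i for the real indices i of group q★ (those with q★·s ≤ (i : ℕ) < r). Moreover, the number of these candidate values, q★ + (r − q★·s), is at most 2s − 1. -/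
/-- Frequency-hiding conditional maximum: with `r` real indexes among `s·s` indexes
partitioned into `s` consecutive groups of size `s` (index `i` in group `⌊i/s⌋`, and
`q★ = ⌊(r-1)/s⌋` the group of the last real index), every group `q < q★` consists
entirely of real indexes; the maximum of `v` over the real indexes equals the maximum of
the candidate values (per-group maxima of the full groups `q < q★` together with the
values at the real indexes of the mixed group `q★`); and the number of candidate values,
`q★ + (r - q★·s)`, is at most `2s - 1`. -/
theorem frequency_hiding_max_correct (s : ℕ) (hs : 0 < s) {α : Type*} [LinearOrder α]
    (v : Fin (s * s) → α) (r : ℕ) (hr1 : 1 ≤ r) (hr2 : r ≤ s * s) :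
    (∀ i : Fin (s * s), (i : ℕ) / s < (r - 1) / s → (i : ℕ) < r) ∧
    ((Finset.univ.filter (fun i : Fin (s * s) => (i : ℕ) < r)).sup'
        (by
          refine ⟨⟨0, Nat.mul_pos hs hs⟩, ?_⟩
          simp only [Finset.mem_filter, Finset.mem_univ, true_and]
          omega) v
      = (((Finset.univ : Finset (Fin ((r - 1) / s))).image
            (fun q : Fin ((r - 1) / s) => (Finset.univ.filter
                (fun i : Fin (s * s) => (i : ℕ) / s = (q : ℕ))).sup'
              (by
                have hqs : (q : ℕ) < s := by
                  have h1 : (q : ℕ) < (r - 1) / s := q.isLt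
                  have h2 : (r - 1) / s < s :=
                    (Nat.div_lt_iff_lt_mul hs).mpr (by omega)
                  omega
                refine ⟨⟨(q : ℕ) * s, by nlinarith⟩, ?_⟩
                simp only [Finset.mem_filter, Finset.mem_univ, true_and]
                exact Nat.mul_div_cancel _ hs) v))
          ∪ ((Finset.univ.filter
                (fun i : Fin (s * s) =>
                  ((r - 1) / s) * s ≤ (i : ℕ) ∧ (i : ℕ) < r)).image v)).max'
        (by
          refine Finset.Nonempty.mono Finset.subset_union_right ?_
          refine Finset.Nonempty.image ?_ v
          have hle : ((r - 1) / s) * s ≤ r - 1 := Nat.div_mul_le_self _ _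
          refine ⟨⟨((r - 1) / s) * s, by omega⟩, ?_⟩
          simp only [Finset.mem_filter, Finset.mem_univ, true_and]
          omega)) ∧
    ((r - 1) / s + (r - ((r - 1) / s) * s) ≤ 2 * s - 1) := by
  have real_of_group_lt : ∀ i : Fin (s * s), (i : ℕ) / s < (r - 1) / s → (i : ℕ) < r := by
    intro i hi
    have := Nat.lt_of_div_lt_div hi
    omega
  refine ⟨real_of_group_lt, ?_, ?_⟩
  · apply le_antisymm
    · refine Finset.sup'_le _ _ fun i hi => ?_
      have hir : (i : ℕ) < r := (Finset.mem_filter.mp hi).2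
      by_cases hq : (i : ℕ) / s < (r - 1) / s
      · refine le_trans ?_ (Finset.le_max' _ _ (Finset.mem_union_left _
          (Finset.mem_image_of_mem _ (Finset.mem_univ ⟨(i : ℕ) / s, hq⟩))))
        exact Finset.le_sup' v (by simp)
      · refine Finset.le_max' _ _ (Finset.mem_union_right _ (Finset.mem_image_of_mem _ ?_))
        refine Finset.mem_filter.mpr ⟨Finset.mem_univ _, ?_, hir⟩
        exact (Nat.le_div_iff_mul_le hs).mp (not_lt.mp hq)
    · refine Finset.max'_le _ _ _ fun y hy => ?_
      rcases Finset.mem_union.mp hy with hy | hy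
      · obtain ⟨q, -, rfl⟩ := Finset.mem_image.mp hy
        refine Finset.sup'_le _ _ fun i hi => Finset.le_sup' v ?_
        refine Finset.mem_filter.mpr ⟨Finset.mem_univ _, real_of_group_lt i ?_⟩
        exact (Finset.mem_filter.mp hi).2 ▸ q.isLt
      · obtain ⟨i, hi, rfl⟩ := Finset.mem_image.mp hy
        exact Finset.le_sup' v
          (Finset.mem_filter.mpr ⟨Finset.mem_univ _, (Finset.mem_filter.mp hi).2.2⟩)
  · have hq : (r - 1) / s < s := (Nat.div_lt_iff_lt_mul hs).mpr (by omega)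
    have hr := Nat.lt_div_mul_add hs (a := r - 1)
    omega
end
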